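/- arXiv:2509.15571 — 2 statements merged into one kernel-verified Lean document; each statement's English description precedes it below -/
import Mathlib

section
/- Let k : ℝ^d → ℝ be a continuous, nonnegative, compactly supported, even function with ∫ k dλ = 1 and finite first moment, and for δ > 0 set k_δ(y) = δ^{-d} k(y/δ). Let δ_n → 0 and let (μ_n) be Borel probability measures on ℝ^d, all supported in a common compact set, converging narrowly to μ, with sup_n ∫_{ℝ^d} (k_{δ_n} * μ_n)² dλ < ∞. Then μ is absolutely continuous with respect to Lebesgue measure and its density ρ satisfies ∫ ρ² dλ ≤ liminf_{n→∞} ∫_{ℝ^d} (k_{δ_n} * μ_n)² dλ. -/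
open MeasureTheory Filter Topology
open scoped ENNReal BoundedContinuousFunction

lemma ext_bound {d : ℕ} (μ : Measure (Fin d → ℝ)) [IsProbabilityMeasure μ] (C : ℝ≥0∞) (hC : C ≠ ⊤)
    (H : ∀ φ : (Fin d → ℝ) → ℝ, Continuous φ → HasCompactSupport φ →
      ENNReal.ofReal (∫ x, φ x ∂μ) ≤ C * eLpNorm φ 2 volume)
    (h : (Fin d → ℝ) → ℝ) (hh : MemLp h 2 (volume + μ)) :
    ENNReal.ofReal (∫ x, h x ∂μ) ≤ C * eLpNorm h 2 volume := by
  have hle1 : (volume : Measure (Fin d → ℝ)) ≤ volume + μ := Measure.le_add_right le_rfl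
  have hle2 : μ ≤ volume + μ := Measure.le_add_left le_rfl
  have : IsFiniteMeasureOnCompacts (volume + μ) := ⟨fun s hs => by
    rw [Measure.add_apply]
    exact ENNReal.add_lt_top.2 ⟨hs.measure_lt_top, measure_lt_top _ _⟩⟩
  have key : ∀ ε : ℝ≥0∞, ε ≠ 0 → 
      ENNReal.ofReal (∫ x, h x ∂μ) ≤ C * (eLpNorm h 2 volume + ε) + ε := by
    intro ε hε
    obtain ⟨g, hgs, hg, hgc, hgm⟩ := hh.exists_hasCompactSupport_eLpNorm_sub_le (by simp) hε
    have hhμ : Integrable h μ := (hh.mono_measure hle2).integrable (by norm_num)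
    have hgμ : Integrable g μ := (hgm.mono_measure hle2).integrable (by norm_num)
    have e1 : ENNReal.ofReal (∫ x, (h - g) x ∂μ) ≤ ε := by
      calc ENNReal.ofReal (∫ x, (h - g) x ∂μ) ≤ ‖∫ x, (h - g) x ∂μ‖ₑ := by
            rw [← ofReal_norm]; exact ENNReal.ofReal_le_ofReal (le_abs_self _)
        _ ≤ ∫⁻ x, ‖(h - g) x‖ₑ ∂μ := enorm_integral_le_lintegral_enorm _
        _ = eLpNorm (h - g) 1 μ := eLpNorm_one_eq_lintegral_enorm.symm
        _ ≤ eLpNorm (h - g) 2 μ := eLpNorm_le_eLpNorm_of_exponent_le (by norm_num)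
            ((hhμ.sub hgμ).aestronglyMeasurable)
        _ ≤ eLpNorm (h - g) 2 (volume + μ) := eLpNorm_mono_measure _ hle2
        _ ≤ ε := hg
    have e2 : eLpNorm g 2 volume ≤ eLpNorm h 2 volume + ε := by
      have : g = h - (h - g) := by simp
      rw [this]
      refine (eLpNorm_sub_le (hh.mono_measure hle1).aestronglyMeasurable
        ((hh.sub hgm).mono_measure hle1).aestronglyMeasurable (by norm_num)).trans ?_
      gcongr
      exact (eLpNorm_mono_measure _ hle1).trans hg
    calc ENNReal.ofReal (∫ x, h x ∂μ) = ENNReal.ofReal (∫ x, g x ∂μ + ∫ x, (h - g) x ∂μ) := by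
          rw [← integral_add hgμ (hhμ.sub hgμ)]; simp
      _ ≤ ENNReal.ofReal (∫ x, g x ∂μ) + ENNReal.ofReal (∫ x, (h - g) x ∂μ) :=
          ENNReal.ofReal_add_le
      _ ≤ C * (eLpNorm h 2 volume + ε) + ε := by
          gcongr
          exact (H g hgc hgs).trans (by gcongr)
  have hlim : Tendsto (fun ε : ℝ≥0∞ => C * (eLpNorm h 2 volume + ε) + ε) (𝓝[≠] 0)
      (𝓝 (C * (eLpNorm h 2 volume + 0) + 0)) := by
    refine Tendsto.mono_left ?_ nhdsWithin_le_nhds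
    refine Tendsto.add ?_ tendsto_id
    exact ENNReal.Tendsto.const_mul (tendsto_const_nhds.add tendsto_id) (Or.inr hC)
  have : (𝓝[≠] (0:ℝ≥0∞)).NeBot := inferInstance
  have := ge_of_tendsto hlim (by
    filter_upwards [self_mem_nhdsWithin] with ε hε using key ε hε)
  simpa using this

lemma eLpNorm_two_sq {α : Type*} [MeasurableSpace α] (ν : Measure α) (f : α → ℝ) :
    eLpNorm f 2 ν ^ 2 = ∫⁻ x, ‖f x‖ₑ ^ 2 ∂ν := by
  have := eLpNorm_nnreal_pow_eq_lintegral (μ := ν) (f := f) (p := 2) (by norm_num)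
  simpa using this

lemma density_bound {d : ℕ} (μ : Measure (Fin d → ℝ)) [IsProbabilityMeasure μ]
    (C : ℝ≥0∞) (hC : C ≠ ⊤)
    (H : ∀ φ : (Fin d → ℝ) → ℝ, Continuous φ → HasCompactSupport φ →
      ENNReal.ofReal (∫ x, φ x ∂μ) ≤ C * eLpNorm φ 2 volume) :
    μ ≪ volume ∧ ∫⁻ x, (μ.rnDeriv volume x) ^ 2 ≤ C ^ 2 := by
  have H' := ext_bound μ C hC H
  have hac : μ ≪ volume := by
    refine Measure.AbsolutelyContinuous.mk fun s hs h0 => ?_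
    have hm : MemLp (s.indicator fun _ => (1:ℝ)) 2 (volume + μ) :=
      memLp_indicator_const 2 hs 1 (Or.inr (by simp [h0]))
    have h1 := H' _ hm
    have h2 : eLpNorm (s.indicator fun _ => (1:ℝ)) 2 volume = 0 := by
      rw [eLpNorm_indicator_const hs (by norm_num) (by norm_num)]; simp [h0]
    rw [h2, mul_zero, integral_indicator hs] at h1
    simpa [measureReal_def] using h1
  refine ⟨hac, ?_⟩
  set f := μ.rnDeriv volume with hf
  have hfm : Measurable f := Measure.measurable_rnDeriv _ _
  set B : ℕ → Set (Fin d → ℝ) := fun N => Metric.ball 0 N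
  set q : ℕ → (Fin d → ℝ) → ℝ≥0∞ := fun N => (B N).indicator (fun x => min (f x) N) with hq
  have hqm : ∀ N, Measurable (q N) := fun N =>
    (hfm.min measurable_const).indicator measurableSet_ball
  have hqf : ∀ N x, q N x ≤ f x := fun N x =>
    (Set.indicator_le_self' (fun _ _ => zero_le) x).trans (min_le_left _ _)
  have hqN : ∀ N x, q N x ≤ (B N).indicator (fun _ => (N : ℝ≥0∞)) x := fun N x =>
    Set.indicator_le_indicator (min_le_right _ _)
  have hqN' : ∀ N x, q N x ≤ N := fun N x =>
    (hqN N x).trans (Set.indicator_le_self' (fun _ _ => zero_le) x)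
  have hqt : ∀ N x, q N x ≠ ⊤ := fun N x =>
    ((hqN' N x).trans_lt (by simp)).ne
  have hbound : ∀ N, ∫⁻ x, q N x ^ 2 ≤ C ^ 2 := by
    intro N
    have hBfin : ((volume + μ : Measure (Fin d → ℝ))) (B N) ≠ ⊤ := by
      simp only [Measure.add_apply, ne_eq, ENNReal.add_eq_top, not_or]
      exact ⟨measure_ball_lt_top.ne, measure_ne_top _ _⟩
    have hm : MemLp (fun x => (q N x).toReal) 2 (volume + μ) := by
      refine MemLp.mono (g := (B N).indicator fun _ => (N:ℝ))
        (memLp_indicator_const 2 measurableSet_ball _ (Or.inr hBfin))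
        (hqm N).ennreal_toReal.aestronglyMeasurable (Eventually.of_forall fun x => ?_)
      have := ENNReal.toReal_mono (by by_cases hx : x ∈ B N <;> simp [hx]) (hqN N x)
      by_cases hx : x ∈ B N
      · simpa [hx] using this
      · simp [hx, hq]
    have h1 := H' _ hm
    set S := eLpNorm (fun x => (q N x).toReal) 2 volume with hS
    have hSt : S ≠ ⊤ := (hm.mono_measure (Measure.le_add_right le_rfl)).eLpNorm_ne_top
    have hS2 : S ^ 2 = ∫⁻ x, q N x ^ 2 := by
      rw [hS, eLpNorm_two_sq]
      refine lintegral_congr fun x => ?_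
      rw [Real.enorm_eq_ofReal ENNReal.toReal_nonneg, ENNReal.ofReal_toReal (hqt N x)]
    have hI : ENNReal.ofReal (∫ x, (q N x).toReal ∂μ) = ∫⁻ x, q N x ∂μ := by
      rw [integral_toReal (hqm N).aemeasurable (Eventually.of_forall fun x => (hqt N x).lt_top)]
      refine ENNReal.ofReal_toReal ?_
      refine ((lintegral_mono (hqN' N)).trans_lt ?_).ne
      simp
    have hI2 : ∫⁻ x, q N x ∂μ = ∫⁻ x, f x * q N x := by
      rw [hf, lintegral_rnDeriv_mul hac (hqm N).aemeasurable]
    have h3 : S ^ 2 ≤ C * S := by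
      rw [hS2]
      refine le_trans ?_ (hI2 ▸ hI ▸ h1)
      refine lintegral_mono fun x => ?_
      rw [sq]; gcongr; exact hqf N x
    rw [← hS2]
    by_cases h0 : S = 0
    · simp [h0]
    · have : S ≤ C := by
        rw [sq] at h3
        exact (ENNReal.mul_le_mul_iff_left h0 hSt).1 h3
      gcongr
  have hmono : Monotone q := by
    intro a b hab x
    refine (Set.indicator_le_indicator_of_subset (Metric.ball_subset_ball (Nat.cast_le.2 hab)) (fun _ => zero_le) x).trans ?_
    refine Set.indicator_le_indicator ?_
    gcongr
  have hlim : ∀ x, Tendsto (fun N => q N x ^ 2) atTop (𝓝 (f x ^ 2)) := by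
    intro x
    have : Tendsto (fun N => q N x) atTop (𝓝 (f x)) := by
      have h1 : Tendsto (fun N : ℕ => min (f x) (N : ℝ≥0∞)) atTop (𝓝 (min (f x) ⊤)) :=
        tendsto_const_nhds.min ENNReal.tendsto_nat_nhds_top
      rw [min_top_right] at h1
      refine h1.congr' ?_
      obtain ⟨N0, hN0⟩ := exists_nat_gt ‖x‖
      filter_upwards [eventually_ge_atTop N0] with N hN
      have : x ∈ B N := by
        simp only [B, mem_ball_zero_iff]
        exact hN0.trans_le (by exact_mod_cast hN)
      simp [hq, this]
    exact ENNReal.Tendsto.pow this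
  have hL := lintegral_tendsto_of_tendsto_of_monotone (μ := volume)
    (f := fun N x => q N x ^ 2) (F := fun x => f x ^ 2)
    (fun N => ((hqm N).pow_const 2).aemeasurable)
    (Eventually.of_forall fun x a b hab => by
      have := hmono hab x
      dsimp only
      gcongr) (Eventually.of_forall hlim)
  exact le_of_tendsto' hL hbound


lemma pairing {d : ℕ} (k : (Fin d → ℝ) → ℝ)
    (hkcont : Continuous k) (hkcs : HasCompactSupport k)
    (δ : ℝ) (hδ : 0 < δ) (μ : Measure (Fin d → ℝ)) [IsProbabilityMeasure μ]
    (φ : (Fin d → ℝ) → ℝ) (hφ : Continuous φ) (hφs : HasCompactSupport φ) :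
    ∫ y, (∫ x, (δ ^ d)⁻¹ * k (δ⁻¹ • (y - x)) ∂μ) * φ y
      = ∫ x, (∫ w, k w * φ (x + δ • w)) ∂μ := by
  simp_rw [← integral_mul_const]
  rw [integral_integral_swap]
  · congr 1 with x
    rw [← integral_add_right_eq_self (μ := volume) _ x]
    simp only [add_sub_cancel_right]
    have := Measure.integral_comp_inv_smul_of_nonneg (μ := (volume : Measure (Fin d → ℝ)))
      (fun w => k w * φ (x + δ • w)) hδ.le
    simp only [smul_inv_smul₀ hδ.ne', Module.finrank_fin_fun, smul_eq_mul] at this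
    simp_rw [mul_assoc, integral_const_mul, add_comm _ x]
    rw [this, ← mul_assoc, inv_mul_cancel₀ (by positivity), one_mul]
  · obtain ⟨c, hc⟩ := hkcs.exists_bound_of_continuous hkcont
    have h1 : Integrable (fun z : (Fin d → ℝ) × (Fin d → ℝ) => φ z.1) (volume.prod μ) :=
      (hφ.integrable_of_hasCompactSupport hφs).comp_fst μ
    refine h1.bdd_mul (c := (δ ^ d)⁻¹ * c)
      (f := fun z : (Fin d → ℝ) × (Fin d → ℝ) => (δ ^ d)⁻¹ * k (δ⁻¹ • (z.1 - z.2))) ?_ ?_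
    · exact Continuous.aestronglyMeasurable (by fun_prop)
    · refine Eventually.of_forall fun z => ?_
      rw [norm_mul, Real.norm_of_nonneg (by positivity : 0 ≤ (δ ^ d)⁻¹)]
      gcongr
      exact hc _

lemma mollify_close {d : ℕ} (k : (Fin d → ℝ) → ℝ)
    (hkcont : Continuous k) (hknn : ∀ y, 0 ≤ k y) (hkcs : HasCompactSupport k)
    (hkint : ∫ y, k y = 1)
    (φ : (Fin d → ℝ) → ℝ) (hφ : Continuous φ) (hφs : HasCompactSupport φ) (ε : ℝ) (hε : 0 < ε) :
    ∃ η > 0, ∀ δ : ℝ, 0 < δ → δ < η → ∀ x, ‖(∫ w, k w * φ (x + δ • w)) - φ x‖ ≤ ε := by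
  have huc : UniformContinuous φ := hφs.uniformContinuous_of_continuous hφ
  obtain ⟨r, hr, hur⟩ := Metric.uniformContinuous_iff.1 huc ε hε
  obtain ⟨R, hR⟩ := hkcs.isCompact.isBounded.exists_norm_le
  have hki : Integrable k := hkcont.integrable_of_hasCompactSupport hkcs
  refine ⟨r / (|R| + 1), by positivity, fun δ hδ hδη x => ?_⟩
  have hi : Integrable (fun w => k w * φ (x + δ • w)) :=
    Continuous.integrable_of_hasCompactSupport (by fun_prop) hkcs.mul_right
  have : (∫ w, k w * φ (x + δ • w)) - φ x = ∫ w, k w * (φ (x + δ • w) - φ x) := by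
    simp_rw [mul_sub]
    rw [integral_sub hi (hki.mul_const _), integral_mul_const, hkint, one_mul]
  rw [this]
  calc _ ≤ ∫ w, k w * ε := by
        refine norm_integral_le_of_norm_le (hki.mul_const _) (Eventually.of_forall fun w => ?_)
        rw [norm_mul, Real.norm_of_nonneg (hknn w)]
        by_cases hw : k w = 0
        · simp [hw]
        · refine mul_le_mul_of_nonneg_left ?_ (hknn w)
          rw [← dist_eq_norm]
          refine (hur ?_).le
          have h1 : ‖w‖ ≤ |R| := (hR w (subset_tsupport _ hw)).trans (le_abs_self _)
          rw [dist_eq_norm, add_sub_cancel_left, norm_smul, Real.norm_of_nonneg hδ.le]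
          rw [lt_div_iff₀ (by positivity)] at hδη
          nlinarith
    _ = ε := by rw [integral_mul_const, hkint, one_mul]

/-- Liminf (Γ-convergence) inequality for the mollified L² energies as `δ → 0`:
if `δₙ → 0`, probability measures `μₙ` supported in a common compact set converge
narrowly to `μ`, and the mollified energies `∫ (k_{δₙ} ⋆ μₙ)²` are uniformly bounded,
then `μ` has a Lebesgue density `ρ` with `∫ ρ² ≤ liminf ∫ (k_{δₙ} ⋆ μₙ)²`. -/
theorem stmt_7 {d : ℕ} (k : (Fin d → ℝ) → ℝ)
    (hkcont : Continuous k) (hknn : ∀ y, 0 ≤ k y)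
    (hkcs : HasCompactSupport k) (hkeven : ∀ y, k (-y) = k y)
    (hkint : ∫ y, k y = 1)
    (hkmom : Integrable (fun y => ‖y‖ * k y))
    (δ : ℕ → ℝ) (hδpos : ∀ n, 0 < δ n) (hδ : Tendsto δ atTop (𝓝 0))
    (μ : ℕ → Measure (Fin d → ℝ)) (μlim : Measure (Fin d → ℝ))
    [∀ n, IsProbabilityMeasure (μ n)] [IsProbabilityMeasure μlim]
    (K : Set (Fin d → ℝ)) (hKcomp : IsCompact K) (hsupp : ∀ n, μ n Kᶜ = 0)
    (hconv : ∀ f : (Fin d → ℝ) →ᵇ ℝ,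
      Tendsto (fun n => ∫ x, f x ∂(μ n)) atTop (𝓝 (∫ x, f x ∂μlim)))
    (hbdd : ∃ M : ℝ≥0∞, M < ⊤ ∧ ∀ n,
      ∫⁻ y, ENNReal.ofReal ((∫ x, ((δ n) ^ d)⁻¹ * k ((δ n)⁻¹ • (y - x)) ∂(μ n)) ^ 2) ≤ M) :
    μlim ≪ volume ∧
      ∫⁻ x, (μlim.rnDeriv volume x) ^ 2 ≤
        atTop.liminf (fun n =>
          ∫⁻ y, ENNReal.ofReal ((∫ x, ((δ n) ^ d)⁻¹ * k ((δ n)⁻¹ • (y - x)) ∂(μ n)) ^ 2)) := by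
  obtain ⟨M, hM, hbd⟩ := hbdd
  set g : ℕ → (Fin d → ℝ) → ℝ :=
    fun n y => ∫ x, ((δ n) ^ d)⁻¹ * k ((δ n)⁻¹ • (y - x)) ∂(μ n) with hg
  change ∀ n, ∫⁻ y, ENNReal.ofReal (g n y ^ 2) ≤ M at hbd
  change _ ∧ _ ≤ atTop.liminf (fun n => ∫⁻ y, ENNReal.ofReal (g n y ^ 2))
  have hgm : ∀ n, StronglyMeasurable (g n) := fun n => by
    refine StronglyMeasurable.integral_prod_right
      (f := fun y x => ((δ n) ^ d)⁻¹ * k ((δ n)⁻¹ • (y - x))) ?_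
    exact Continuous.stronglyMeasurable (by unfold Function.uncurry; fun_prop)
  have hE : ∀ n, ∫⁻ y, ENNReal.ofReal (g n y ^ 2) = eLpNorm (g n) 2 volume ^ 2 := fun n => by
    rw [eLpNorm_two_sq]
    refine lintegral_congr fun y => ?_
    rw [← ofReal_norm, ← ENNReal.ofReal_pow (norm_nonneg _), Real.norm_eq_abs, sq_abs]
  simp_rw [hE] at hbd ⊢
  set L := atTop.liminf (fun n => eLpNorm (g n) 2 volume ^ 2) with hL
  have hLt : L ≠ ⊤ := by
    refine ne_top_of_le_ne_top hM.ne ?_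
    exact liminf_le_of_le (by isBoundedDefault) fun b hb => by
      obtain ⟨n, hn⟩ := hb.exists
      exact hn.trans (hbd n)
  have hsq : (L ^ (1 / 2 : ℝ)) ^ 2 = L := by
    rw [← ENNReal.rpow_natCast, ← ENNReal.rpow_mul]; norm_num
  have main := density_bound μlim (L ^ (1 / 2 : ℝ))
    (ENNReal.rpow_ne_top_of_nonneg (by norm_num) hLt) ?_
  · rwa [hsq] at main
  intro φ hφ hφs
  -- convergence of the pairings
  have hφi : ∀ ν : Measure (Fin d → ℝ), [IsProbabilityMeasure ν] → Integrable φ ν :=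
    fun ν _ => hφ.integrable_of_hasCompactSupport hφs
  have hlim1 : Tendsto (fun n => ∫ x, φ x ∂(μ n)) atTop (𝓝 (∫ x, φ x ∂μlim)) := by
    obtain ⟨c, hc⟩ := hφs.exists_bound_of_continuous hφ
    exact hconv (BoundedContinuousFunction.ofNormedAddCommGroup φ hφ c hc)
  have hlim2 : Tendsto (fun n => (∫ y, g n y * φ y) - ∫ x, φ x ∂(μ n)) atTop (𝓝 0) := by
    rw [Metric.tendsto_nhds]
    intro ε hε
    obtain ⟨η, hη, hcl⟩ := mollify_close k hkcont hknn hkcs hkint φ hφ hφs (ε / 2) (by positivity)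
    filter_upwards [hδ.eventually (gt_mem_nhds hη)] with n hn
    have hcl' := hcl (δ n) (hδpos n) hn
    rw [hg, pairing k hkcont hkcs (δ n) (hδpos n) (μ n) φ hφ hφs, dist_zero_right]
    have hsm : StronglyMeasurable (fun x => ∫ w, k w * φ (x + δ n • w)) := by
      refine StronglyMeasurable.integral_prod_right
        (f := fun x w => k w * φ (x + δ n • w)) ?_
      exact Continuous.stronglyMeasurable (by unfold Function.uncurry; fun_prop)
    have hid : Integrable (fun x => (∫ w, k w * φ (x + δ n • w)) - φ x) (μ n) :=
      Integrable.of_bound (hsm.aestronglyMeasurable.sub (hφi (μ n)).aestronglyMeasurable) (ε / 2)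
        (Eventually.of_forall hcl')
    have hi1 : Integrable (fun x => ∫ w, k w * φ (x + δ n • w)) (μ n) := by
      refine (hid.add (hφi (μ n))).congr (Eventually.of_forall fun x => ?_)
      simp
    rw [← integral_sub hi1 (hφi (μ n))]
    refine lt_of_le_of_lt (norm_integral_le_of_norm_le_const (Eventually.of_forall hcl')) ?_
    simp; linarith
  have hlim : Tendsto (fun n => ∫ y, g n y * φ y) atTop (𝓝 (∫ x, φ x ∂μlim)) := by
    simpa using hlim2.add hlim1
  have hlimE : Tendsto (fun n => ENNReal.ofReal (∫ y, g n y * φ y) ^ 2) atTop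
      (𝓝 (ENNReal.ofReal (∫ x, φ x ∂μlim) ^ 2)) :=
    ENNReal.Tendsto.pow (ENNReal.tendsto_ofReal hlim)
  have hCS : ∀ n, ENNReal.ofReal (∫ y, g n y * φ y) ^ 2
      ≤ eLpNorm (g n) 2 volume ^ 2 * eLpNorm φ 2 volume ^ 2 := by
    intro n
    rw [← mul_pow]
    gcongr
    calc ENNReal.ofReal (∫ y, g n y * φ y) ≤ ‖∫ y, g n y * φ y‖ₑ := by
          rw [← ofReal_norm]; exact ENNReal.ofReal_le_ofReal (le_abs_self _)
      _ ≤ ∫⁻ y, ‖g n y * φ y‖ₑ := enorm_integral_le_lintegral_enorm _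
      _ = eLpNorm (g n • φ) 1 volume := by rw [eLpNorm_one_eq_lintegral_enorm]; rfl
      _ ≤ _ := eLpNorm_smul_le_mul_eLpNorm hφ.aestronglyMeasurable
          (hgm n).aestronglyMeasurable
  have hNt : eLpNorm φ 2 volume ≠ ⊤ := (hφ.memLp_of_hasCompactSupport hφs).eLpNorm_ne_top
  have hfin : ENNReal.ofReal (∫ x, φ x ∂μlim) ^ 2 ≤ L * eLpNorm φ 2 volume ^ 2 := by
    rw [mul_comm, hL, ← ENNReal.liminf_mul_const_of_ne_top (ENNReal.pow_ne_top hNt), ← hlimE.liminf_eq]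
    exact liminf_le_liminf (Eventually.of_forall hCS)
  rw [← hsq, ← mul_pow] at hfin
  exact (ENNReal.pow_le_pow_left_iff two_ne_zero).1 hfin
end

section
/- Let f_0, f_1, …, f_m : ℝ^d → ℝ^d be continuously differentiable vector fields with linear growth: ‖f_i(x)‖ ≤ C(1 + ‖x‖) for all x and all i, for some C > 0. Let U ⊆ ℝ^m be nonempty, compact, and convex, let Ω ⊆ ℝ^d be nonempty and compact, and let T > 0. Then the reachable set R^T_Ω = { y ∈ ℝ^d : there exist x_0 ∈ Ω, a measurable u : [0,T] → ℝ^m with u(t) ∈ U a.e., and an absolutely continuous x : [0,T] → ℝ^d with x(0) = x_0, x'(t) = f_0(x(t)) + Σ_{i=1}^m u_i(t) f_i(x(t)) for a.e. t, and x(T) = y } is a compact subset of ℝ^d. -/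
open MeasureTheory Filter Topology

/-- Sequential Arzela-Ascoli for Lipschitz functions on an interval. -/
theorem aux_arzela {F : Type*} [NormedAddCommGroup F] [ProperSpace F] {T : ℝ} (hT : 0 ≤ T)
    (g : ℕ → ℝ → F) (K : NNReal) (R : ℝ)
    (hL : ∀ n, LipschitzOnWith K (g n) (Set.Icc 0 T))
    (hR : ∀ n, ∀ t ∈ Set.Icc (0:ℝ) T, ‖g n t‖ ≤ R) :
    ∃ (φ : ℕ → ℕ) (h : ℝ → F), StrictMono φ ∧ LipschitzOnWith K h (Set.Icc 0 T) ∧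
      ∀ t ∈ Set.Icc (0:ℝ) T, Tendsto (fun n => g (φ n) t) atTop (𝓝 (h t)) := by
  let G : ℕ → BoundedContinuousFunction (Set.Icc (0:ℝ) T) F := fun n =>
    BoundedContinuousFunction.mkOfCompact ⟨(Set.Icc (0:ℝ) T).domRestrict (g n), (hL n).continuousOn.domRestrict⟩
  have hG : ∀ n (t : Set.Icc (0:ℝ) T), G n t = g n t := fun n t => rfl
  have hc : IsCompact (closure (Set.range G)) := by
    refine BoundedContinuousFunction.arzela_ascoli (Metric.closedBall 0 R) (isCompact_closedBall _ _) _ ?_ ?_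
    · rintro _ t ⟨n, rfl⟩
      simpa [hG] using hR n t t.2
    · apply UniformEquicontinuous.equicontinuous
      apply LipschitzWith.uniformEquicontinuous _ K
      rintro ⟨_, n, rfl⟩
      exact (hL n).to_restrict
  obtain ⟨H, -, φ, hφ, hlim⟩ := hc.tendsto_subseq (x := G) (fun n => subset_closure ⟨n, rfl⟩)
  have hpt : ∀ t ∈ Set.Icc (0:ℝ) T, Tendsto (fun n => g (φ n) t) atTop
      (𝓝 (Set.IccExtend hT H t)) := by
    intro t ht
    rw [Set.IccExtend_of_mem _ _ ht]
    have := ((continuous_eval_const (F := BoundedContinuousFunction (Set.Icc (0:ℝ) T) F) (⟨t, ht⟩ : Set.Icc (0:ℝ) T)).tendsto H).comp hlim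
    exact this
  refine ⟨φ, Set.IccExtend hT H, hφ, ?_, hpt⟩
  apply LipschitzOnWith.of_dist_le_mul
  intro s hs t ht
  exact le_of_tendsto ((hpt s hs).dist (hpt t ht)) (Eventually.of_forall fun n => (hL _).dist_le_mul s hs t ht)

/-- Gronwall a priori bound in integral form. -/
theorem aux_gronwall {F : Type*} [NormedAddCommGroup F] [NormedSpace ℝ F] {T : ℝ} (hT : 0 ≤ T)
    (x h : ℝ → F) (x₀ : F) (r K : ℝ) (hK : 0 ≤ K) (hr : ‖x₀‖ ≤ r)
    (hx : ContinuousOn x (Set.Icc 0 T))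
    (heq : ∀ t ∈ Set.Icc (0:ℝ) T, x t = x₀ + ∫ s in Set.Ioc (0:ℝ) t, h s)
    (hh : ∀ᵐ t ∂(volume.restrict (Set.Icc (0:ℝ) T)), ‖h t‖ ≤ K * (1 + ‖x t‖)) :
    ∀ t ∈ Set.Icc (0:ℝ) T, ‖x t‖ ≤ r + K * gronwallBound 0 K (1 + r) T := by
  have hr0 : 0 ≤ r := (norm_nonneg _).trans hr
  let X : ℝ → F := Set.IccExtend hT ((Set.Icc (0:ℝ) T).domRestrict x)
  have hXc : Continuous X := hx.domRestrict.Icc_extend'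
  have hXe : ∀ t ∈ Set.Icc (0:ℝ) T, X t = x t := fun t ht => Set.IccExtend_of_mem _ _ ht
  have hc1 : Continuous (fun s => 1 + ‖X s‖) := by fun_prop
  let φ : ℝ → ℝ := fun t => ∫ s in (0:ℝ)..t, (1 + ‖X s‖)
  have hd : ∀ t, HasDerivAt φ (1 + ‖X t‖) t := fun t => (hc1.integral_hasStrictDerivAt 0 t).hasDerivAt
  have hφ0 : ∀ t, 0 ≤ t → 0 ≤ φ t := fun t ht =>
    intervalIntegral.integral_nonneg ht (fun s _ => by positivity)
  have hb : ∀ t ∈ Set.Icc (0:ℝ) T, ‖x t‖ ≤ r + K * φ t := by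
    intro t ht
    rw [heq t ht]
    refine (norm_add_le _ _).trans (add_le_add hr ?_)
    have h1 : K * φ t = ∫ s in Set.Ioc (0:ℝ) t, K * (1 + ‖X s‖) := by
      rw [integral_const_mul, ← intervalIntegral.integral_of_le ht.1]
    rw [h1]
    have hsub : Set.Ioc (0:ℝ) t ⊆ Set.Icc 0 T := fun s hs => ⟨hs.1.le, hs.2.trans ht.2⟩
    refine norm_integral_le_of_norm_le ?_ ?_
    · exact ((by fun_prop : Continuous (fun s => K * (1 + ‖X s‖))).integrableOn_Icc (a := 0) (b := t)).mono_set Set.Ioc_subset_Icc_self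
    · filter_upwards [ae_restrict_of_ae_restrict_of_subset hsub hh, ae_restrict_mem measurableSet_Ioc] with s hs hs'
      rw [hXe s (hsub hs')]; exact hs
  have hg := norm_le_gronwallBound_of_norm_deriv_right_le (f := φ) (f' := fun t => 1 + ‖X t‖)
    (δ := 0) (K := K) (ε := 1 + r) (a := 0) (b := T)
    (fun t _ => (hd t).continuousAt.continuousWithinAt) (fun t _ => (hd t).hasDerivWithinAt)
    (by simp [φ]) (by
      intro t ht
      have ht' : t ∈ Set.Icc 0 T := ⟨ht.1, ht.2.le⟩
      have := hb t ht'
      rw [Real.norm_of_nonneg (by positivity), Real.norm_of_nonneg (hφ0 t ht.1), hXe t ht']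
      linarith)
  intro t ht
  refine (hb t ht).trans ?_
  have h1 := hg t ht
  rw [sub_zero, Real.norm_of_nonneg (hφ0 t ht.1)] at h1
  have h2 := gronwallBound_mono (le_refl (0:ℝ)) (by linarith : 0 ≤ 1 + r) hK ht.2
  have := mul_le_mul_of_nonneg_left (h1.trans h2) hK
  linarith

/-- Weak convergence tested against Lipschitz functions. -/
theorem aux_weak {t : ℝ} (ht : 0 ≤ t) (b : ℕ → ℝ → ℝ) (M : ℝ)
    (hbi : ∀ n, IntervalIntegrable (b n) volume 0 t)
    (hM : ∀ n, ∀ᵐ s ∂(volume.restrict (Set.Ioc (0:ℝ) t)), ‖b n s‖ ≤ M)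
    (hb : ∀ s ∈ Set.Icc (0:ℝ) t, Tendsto (fun n => ∫ r in (0:ℝ)..s, b n r) atTop (𝓝 0))
    (g : ℝ → ℝ) (K : NNReal) (hg : LipschitzOnWith K g (Set.Icc 0 t)) :
    Tendsto (fun n => ∫ s in (0:ℝ)..t, b n s * g s) atTop (𝓝 0) := by
  have hgac : AbsolutelyContinuousOnInterval g 0 t :=
    LipschitzOnWith.absolutelyContinuousOnInterval (K := K) (by rwa [Set.uIcc_of_le ht])
  let W : ℕ → ℝ → ℝ := fun n s => ∫ r in (0:ℝ)..s, b n r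
  have hWac : ∀ n, AbsolutelyContinuousOnInterval (W n) 0 t := fun n =>
    (hbi n).absolutelyContinuousOnInterval_intervalIntegral (by simp)
  have key : ∀ n, ∫ s in (0:ℝ)..t, b n s * g s = g t * W n t - ∫ s in (0:ℝ)..t, deriv g s * W n s := by
    intro n
    have h1 := hgac.integral_mul_deriv_eq_deriv_mul (hWac n)
    have h2 : ∫ s in (0:ℝ)..t, b n s * g s = ∫ s in (0:ℝ)..t, g s * deriv (W n) s := by
      apply intervalIntegral.integral_congr_ae
      filter_upwards [(hbi n).ae_hasDerivAt_integral] with s hs hs'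
      rw [(hs (Set.uIoc_subset_uIcc hs') 0 (by simp)).deriv, mul_comm]
    rw [h2, h1]
    simp [W]
  have hM0 : ∀ n, ∀ s ∈ Set.Icc (0:ℝ) t, ‖W n s‖ ≤ M * s := by
    intro n s hs
    have := intervalIntegral.norm_integral_le_of_norm_le_const_ae (a := 0) (b := s) (C := M) (f := b n) (by
      have := (ae_restrict_iff' measurableSet_Ioc).1 (hM n)
      filter_upwards [this] with r hr hr'
      rw [Set.uIoc_of_le hs.1] at hr'
      exact hr ⟨hr'.1, hr'.2.trans hs.2⟩)
    rwa [sub_zero, abs_of_nonneg hs.1] at this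
  have hlim : Tendsto (fun n => ∫ s in (0:ℝ)..t, deriv g s * W n s) atTop
      (𝓝 (∫ s in (0:ℝ)..t, deriv g s * 0)) := by
    apply intervalIntegral.tendsto_integral_filter_of_dominated_convergence (fun s => ‖deriv g s‖ * (M * s))
    · refine Eventually.of_forall fun n => ?_
      exact (hgac.intervalIntegrable_deriv.mul_continuousOn (hWac n).continuousOn).aestronglyMeasurable_restrict_uIoc
    · refine Eventually.of_forall fun n => Eventually.of_forall fun s hs => ?_
      rw [Set.uIoc_of_le ht] at hs
      rw [norm_mul]
      exact mul_le_mul_of_nonneg_left (hM0 n s ⟨hs.1.le, hs.2⟩) (norm_nonneg _)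
    · exact hgac.intervalIntegrable_deriv.norm.mul_continuousOn (by fun_prop)
    · refine Eventually.of_forall fun s hs => ?_
      rw [Set.uIoc_of_le ht] at hs
      exact (hb s ⟨hs.1.le, hs.2⟩).const_mul _
  simp only [key]
  have := ((hb t ⟨ht, le_rfl⟩).const_mul (g t)).sub hlim
  simpa using this

/-- Sequential weak compactness of the set of controls. -/
theorem aux_control {m : ℕ} {U : Set (Fin m → ℝ)} (hUcomp : IsCompact U) (hUconv : Convex ℝ U)
    {T : ℝ} (hT : 0 ≤ T) (B : NNReal) (hB : ∀ v ∈ U, ‖v‖ ≤ B) (u : ℕ → ℝ → Fin m → ℝ)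
    (hu : ∀ n, Measurable (u n))
    (huU : ∀ n, ∀ᵐ t ∂(volume.restrict (Set.Icc (0:ℝ) T)), u n t ∈ U) :
    ∃ (φ : ℕ → ℕ) (w : ℝ → Fin m → ℝ), StrictMono φ ∧ Measurable w ∧
      (∀ᵐ t ∂(volume.restrict (Set.Icc (0:ℝ) T)), w t ∈ U) ∧
      ∀ t ∈ Set.Icc (0:ℝ) T, ∀ i, Tendsto (fun n => ∫ s in (0:ℝ)..t, u (φ n) s i) atTop
        (𝓝 (∫ s in (0:ℝ)..t, w s i)) := by
  have hui : ∀ n, IntegrableOn (u n) (Set.Icc 0 T) := fun n =>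
    Measure.integrableOn_of_bounded (M := B) (by simp) (hu n).aestronglyMeasurable
      ((huU n).mono fun t ht => hB _ ht)
  have huii : ∀ n, ∀ s ∈ Set.Icc (0:ℝ) T, ∀ t ∈ Set.Icc (0:ℝ) T, IntervalIntegrable (u n) volume s t := by
    intro n s hs t ht
    rw [intervalIntegrable_iff]
    exact (hui n).mono_set (Set.uIoc_subset_uIcc.trans (Set.uIcc_subset_Icc hs ht))
  let v : ℕ → ℝ → Fin m → ℝ := fun n t => ∫ s in (0:ℝ)..t, u n s
  have hvs : ∀ n, ∀ s ∈ Set.Icc (0:ℝ) T, ∀ t ∈ Set.Icc (0:ℝ) T, v n t - v n s = ∫ r in s..t, u n r := by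
    intro n s hs t ht
    have h0 : (0:ℝ) ∈ Set.Icc (0:ℝ) T := ⟨le_rfl, hT⟩
    exact intervalIntegral.integral_interval_sub_left (huii n 0 h0 t ht) (huii n 0 h0 s hs)
  have hLip : ∀ n, LipschitzOnWith B (v n) (Set.Icc 0 T) := by
    intro n
    apply LipschitzOnWith.of_dist_le_mul
    intro t ht s hs
    rw [dist_eq_norm, hvs n s hs t ht, Real.dist_eq]
    apply intervalIntegral.norm_integral_le_of_norm_le_const_ae
    filter_upwards [(ae_restrict_iff' measurableSet_Icc).1 (huU n)] with r hr hr'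
    exact hB _ (hr ((Set.uIoc_subset_uIcc.trans (Set.uIcc_subset_Icc hs ht)) hr'))
  have hbd : ∀ n, ∀ t ∈ Set.Icc (0:ℝ) T, ‖v n t‖ ≤ B * T := by
    intro n t ht
    have h0 : (0:ℝ) ∈ Set.Icc (0:ℝ) T := ⟨le_rfl, hT⟩
    have := (hLip n).dist_le_mul t ht 0 h0
    have hv0 : v n 0 = 0 := by simp [v]
    rw [hv0, dist_zero_right, Real.dist_eq, sub_zero, abs_of_nonneg ht.1] at this
    exact this.trans (by gcongr; exact ht.2)
  obtain ⟨φ, V, hφ, hVL, hV⟩ := aux_arzela hT v B _ hLip hbd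
  have hV0 : V 0 = 0 := by
    refine tendsto_nhds_unique (hV 0 ⟨le_rfl, hT⟩) ?_
    simp [v]
  have hVi : ∀ i, LipschitzOnWith B (fun t => V t i) (Set.Icc 0 T) := by
    intro i
    have := (LipschitzWith.eval (α := fun _ : Fin m => ℝ) i).comp_lipschitzOnWith hVL
    rw [one_mul] at this
    exact this
  have hVac : ∀ i, ∀ t ∈ Set.Icc (0:ℝ) T, AbsolutelyContinuousOnInterval (fun t => V t i) 0 t := by
    intro i t ht
    apply LipschitzOnWith.absolutelyContinuousOnInterval (K := B)
    rw [Set.uIcc_of_le ht.1]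
    exact (hVi i).mono (Set.Icc_subset_Icc_right ht.2)
  have hmean : ∀ s ∈ Set.Icc (0:ℝ) T, ∀ t ∈ Set.Icc (0:ℝ) T, s < t → slope V s t ∈ U := by
    intro s hs t ht hst
    have h1 : ∀ n, slope (v n) s t ∈ U := by
      intro n
      have hsub : Set.Ioc s t ⊆ Set.Icc 0 T := fun r hr => ⟨hs.1.trans hr.1.le, hr.2.trans ht.2⟩
      have := hUconv.set_average_mem (μ := volume) (t := Set.Ioc s t) (f := u n) hUcomp.isClosed
        (by simp [hst]) (by simp) (ae_restrict_of_ae_restrict_of_subset hsub (huU n))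
        ((hui n).mono_set hsub)
      rw [setAverage_eq, ← intervalIntegral.integral_of_le hst.le, ← hvs n s hs t ht] at this
      simpa [slope, hst.le] using this
    refine hUcomp.isClosed.mem_of_tendsto (b := atTop) (f := fun n => slope (v (φ n)) s t) ?_ (Eventually.of_forall fun n => h1 _)
    exact ((hV t ht).sub (hV s hs)).const_smul _
  refine ⟨φ, fun t i => deriv (fun t => V t i) t, hφ, ?_, ?_, ?_⟩
  · exact measurable_pi_lambda _ fun i => measurable_deriv _
  · have hd : ∀ᵐ t : ℝ, ∀ i, t ∈ Set.uIcc 0 T → DifferentiableAt ℝ (fun t => V t i) t :=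
      ae_all_iff.2 fun i => (hVac i T ⟨hT, le_rfl⟩).ae_differentiableAt
    have hne : ∀ᵐ t : ℝ, t ≠ T := by simp [ae_iff, measure_singleton]
    rw [ae_restrict_iff' measurableSet_Icc]
    filter_upwards [hd, hne] with t ht htT htm
    have hD : HasDerivAt V (fun i => deriv (fun t => V t i) t) t :=
      hasDerivAt_pi.2 fun i => (ht i (by rwa [Set.uIcc_of_le hT])).hasDerivAt
    have hlt : t < T := lt_of_le_of_ne htm.2 htT
    have hs := (hasDerivAt_iff_tendsto_slope.1 hD).mono_left (nhdsWithin_mono t (fun r (hr : t < r) => (ne_of_gt hr)) : 𝓝[>] t ≤ 𝓝[≠] t)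
    refine hUcomp.isClosed.mem_of_tendsto hs ?_
    filter_upwards [Ioo_mem_nhdsGT hlt] with r hr
    exact hmean t htm r ⟨htm.1.trans hr.1.le, hr.2.le⟩ hr.1
  · intro t ht i
    rw [(hVac i t ht).integral_deriv_eq_sub, hV0]
    simp only [Pi.zero_apply, sub_zero]
    have h1 := (continuous_apply i).continuousAt.tendsto.comp (hV t ht)
    refine h1.congr fun n => ?_
    have h0 : (0:ℝ) ∈ Set.Icc (0:ℝ) T := ⟨le_rfl, hT⟩
    exact ((ContinuousLinearMap.proj (R := ℝ) (φ := fun _ : Fin m => ℝ) i).intervalIntegral_comp_comm (huii (φ n) 0 h0 t ht)).symm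

/-- Product of a weakly convergent and a pointwise convergent sequence, scalar version. -/
theorem aux_prod {t : ℝ} (ht : 0 ≤ t) (a : ℕ → ℝ → ℝ) (a' : ℝ → ℝ) (M Q : ℝ)
    (ham : ∀ n, Measurable (a n)) (ham' : Measurable a')
    (hM : ∀ n, ∀ᵐ s ∂(volume.restrict (Set.Ioc (0:ℝ) t)), ‖a n s‖ ≤ M)
    (hM' : ∀ᵐ s ∂(volume.restrict (Set.Ioc (0:ℝ) t)), ‖a' s‖ ≤ M)
    (hlim : ∀ s ∈ Set.Icc (0:ℝ) t, Tendsto (fun n => ∫ r in (0:ℝ)..s, a n r) atTop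
      (𝓝 (∫ r in (0:ℝ)..s, a' r)))
    (g : ℕ → ℝ → ℝ) (g' : ℝ → ℝ) (K : NNReal)
    (hgc : ∀ n, ContinuousOn (g n) (Set.Icc 0 t))
    (hgQ : ∀ n, ∀ s ∈ Set.Icc (0:ℝ) t, ‖g n s‖ ≤ Q)
    (hg' : LipschitzOnWith K g' (Set.Icc 0 t))
    (hglim : ∀ s ∈ Set.Icc (0:ℝ) t, Tendsto (fun n => g n s) atTop (𝓝 (g' s))) :
    Tendsto (fun n => ∫ s in (0:ℝ)..t, a n s * g n s) atTop (𝓝 (∫ s in (0:ℝ)..t, a' s * g' s)) := by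
  have hint : ∀ (c : ℝ → ℝ), Measurable c →
      (∀ᵐ s ∂(volume.restrict (Set.Ioc (0:ℝ) t)), ‖c s‖ ≤ M) → IntervalIntegrable c volume 0 t := by
    intro c hc hcM
    rw [intervalIntegrable_iff, Set.uIoc_of_le ht]
    exact Measure.integrableOn_of_bounded (by simp) hc.aestronglyMeasurable hcM
  have hai := fun n => hint _ (ham n) (hM n)
  have hai' := hint _ ham' hM'
  have hgQ' : ∀ s ∈ Set.Icc (0:ℝ) t, ‖g' s‖ ≤ Q := fun s hs =>
    le_of_tendsto (hglim s hs).norm (Eventually.of_forall fun n => hgQ n s hs)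
  have huIcc : Set.uIcc 0 t = Set.Icc 0 t := Set.uIcc_of_le ht
  have h1 : Tendsto (fun n => ∫ s in (0:ℝ)..t, a n s * (g n s - g' s)) atTop
      (𝓝 (∫ s in (0:ℝ)..t, (0:ℝ))) := by
    apply intervalIntegral.tendsto_integral_filter_of_dominated_convergence (fun _ => M * (Q + Q))
    · refine Eventually.of_forall fun n => ?_
      exact ((hai n).mul_continuousOn (by rw [huIcc]; exact (hgc n).sub hg'.continuousOn)).aestronglyMeasurable_restrict_uIoc
    · refine Eventually.of_forall fun n => ?_
      filter_upwards [(ae_restrict_iff' measurableSet_Ioc).1 (hM n)] with s hs hs'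
      rw [Set.uIoc_of_le ht] at hs'
      have hs2 : s ∈ Set.Icc 0 t := ⟨hs'.1.le, hs'.2⟩
      rw [norm_mul]
      have := (norm_sub_le (g n s) (g' s)).trans (add_le_add (hgQ n s hs2) (hgQ' s hs2))
      exact mul_le_mul (hs hs') this (norm_nonneg _) ((norm_nonneg _).trans (hs hs'))
    · exact intervalIntegrable_const
    · have hall : ∀ᵐ s : ℝ, ∀ n, s ∈ Set.Ioc 0 t → ‖a n s‖ ≤ M :=
        ae_all_iff.2 fun n => (ae_restrict_iff' measurableSet_Ioc).1 (hM n)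
      filter_upwards [hall] with s hs hs'
      rw [Set.uIoc_of_le ht] at hs'
      have hs2 : s ∈ Set.Icc 0 t := ⟨hs'.1.le, hs'.2⟩
      have h0 : Tendsto (fun n => g n s - g' s) atTop (𝓝 0) := by
        simpa using (hglim s hs2).sub_const (g' s)
      have h0' : Tendsto (fun n => M * ‖g n s - g' s‖) atTop (𝓝 0) := by
        simpa using h0.norm.const_mul M
      refine squeeze_zero_norm (fun n => ?_) h0'
      rw [norm_mul]
      exact mul_le_mul_of_nonneg_right (hs n hs') (norm_nonneg _)
  have h2 : Tendsto (fun n => ∫ s in (0:ℝ)..t, (a n s - a' s) * g' s) atTop (𝓝 0) := by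
    refine aux_weak ht (fun n s => a n s - a' s) (M + M) (fun n => (hai n).sub hai') ?_ ?_ g' K hg'
    · intro n
      filter_upwards [hM n, hM'] with s hs hs'
      exact (norm_sub_le _ _).trans (add_le_add hs hs')
    · intro s hs
      have hsub : Set.uIcc 0 s ⊆ Set.uIcc 0 t := by
        rw [huIcc, Set.uIcc_of_le hs.1]; exact Set.Icc_subset_Icc_right hs.2
      have := (hlim s hs).sub_const (∫ r in (0:ℝ)..s, a' r)
      rw [sub_self] at this
      refine this.congr fun n => ?_
      rw [intervalIntegral.integral_sub ((hai n).mono_set hsub) (hai'.mono_set hsub)]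
  have h3 := (h1.add h2).add_const (∫ s in (0:ℝ)..t, a' s * g' s)
  simp only [intervalIntegral.integral_zero, zero_add] at h3
  refine h3.congr fun n => ?_
  have i1 : IntervalIntegrable (fun s => a n s * (g n s - g' s)) volume 0 t :=
    (hai n).mul_continuousOn (by rw [huIcc]; exact (hgc n).sub hg'.continuousOn)
  have i2 : IntervalIntegrable (fun s => (a n s - a' s) * g' s) volume 0 t :=
    ((hai n).sub hai').mul_continuousOn (by rw [huIcc]; exact hg'.continuousOn)
  have i3 : IntervalIntegrable (fun s => a' s * g' s) volume 0 t :=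
    hai'.mul_continuousOn (by rw [huIcc]; exact hg'.continuousOn)
  rw [← intervalIntegral.integral_add i1 i2, ← intervalIntegral.integral_add (i1.add i2) i3]
  congr 1
  ext s
  ring

theorem aux_integrable {d : ℕ} {t : ℝ} (ht : 0 ≤ t) (a : ℝ → ℝ) (M : ℝ) (ham : Measurable a)
    (hM : ∀ᵐ s ∂(volume.restrict (Set.Ioc (0:ℝ) t)), ‖a s‖ ≤ M)
    (g : ℝ → EuclideanSpace ℝ (Fin d)) (hgc : ContinuousOn g (Set.Icc 0 t)) :
    IntervalIntegrable (fun s => a s • g s) volume 0 t := by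
  have hint : IntervalIntegrable a volume 0 t := by
    rw [intervalIntegrable_iff, Set.uIoc_of_le ht]
    exact Measure.integrableOn_of_bounded (by simp) ham.aestronglyMeasurable hM
  exact hint.smul_continuousOn (by rwa [Set.uIcc_of_le ht])

theorem aux_prod_vec {d : ℕ} {t : ℝ} (ht : 0 ≤ t) (a : ℕ → ℝ → ℝ) (a' : ℝ → ℝ) (M Q : ℝ)
    (ham : ∀ n, Measurable (a n)) (ham' : Measurable a')
    (hM : ∀ n, ∀ᵐ s ∂(volume.restrict (Set.Ioc (0:ℝ) t)), ‖a n s‖ ≤ M)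
    (hM' : ∀ᵐ s ∂(volume.restrict (Set.Ioc (0:ℝ) t)), ‖a' s‖ ≤ M)
    (hlim : ∀ s ∈ Set.Icc (0:ℝ) t, Tendsto (fun n => ∫ r in (0:ℝ)..s, a n r) atTop
      (𝓝 (∫ r in (0:ℝ)..s, a' r)))
    (g : ℕ → ℝ → EuclideanSpace ℝ (Fin d)) (g' : ℝ → EuclideanSpace ℝ (Fin d)) (K : NNReal)
    (hgc : ∀ n, ContinuousOn (g n) (Set.Icc 0 t))
    (hgQ : ∀ n, ∀ s ∈ Set.Icc (0:ℝ) t, ‖g n s‖ ≤ Q)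
    (hg' : LipschitzOnWith K g' (Set.Icc 0 t))
    (hglim : ∀ s ∈ Set.Icc (0:ℝ) t, Tendsto (fun n => g n s) atTop (𝓝 (g' s))) :
    Tendsto (fun n => ∫ s in (0:ℝ)..t, a n s • g n s) atTop (𝓝 (∫ s in (0:ℝ)..t, a' s • g' s)) := by
  have hco : ∀ j : Fin d, Tendsto (fun n => (∫ s in (0:ℝ)..t, a n s • g n s) j) atTop
      (𝓝 ((∫ s in (0:ℝ)..t, a' s • g' s) j)) := by
    intro j
    let P : EuclideanSpace ℝ (Fin d) →L[ℝ] ℝ := EuclideanSpace.proj j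
    have e : ∀ f : ℝ → EuclideanSpace ℝ (Fin d), IntervalIntegrable f volume 0 t →
        (∫ s in (0:ℝ)..t, f s) j = ∫ s in (0:ℝ)..t, (f s) j := fun f hf =>
      (P.intervalIntegral_comp_comm hf).symm
    rw [e _ (aux_integrable ht a' M ham' hM' g' hg'.continuousOn)]
    simp only [fun n => e _ (aux_integrable ht (a n) M (ham n) (hM n) (g n) (hgc n)),
      PiLp.smul_apply, smul_eq_mul]
    have hPL : LipschitzWith ‖P‖₊ P := P.lipschitz
    refine aux_prod ht a a' M Q ham ham' hM hM' hlim (fun n s => g n s j) (fun s => g' s j) (‖P‖₊ * K) ?_ ?_ ?_ ?_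
    · exact fun n => P.continuous.comp_continuousOn (hgc n)
    · exact fun n s hs => (PiLp.norm_apply_le _ _).trans (hgQ n s hs)
    · exact hPL.comp_lipschitzOnWith hg'
    · exact fun s hs => (P.continuous.tendsto _).comp (hglim s hs)
  have h1 := (PiLp.continuous_toLp 2 (fun _ : Fin d => ℝ)).continuousAt.tendsto.comp (tendsto_pi_nhds.2 hco)
  exact h1

theorem stmt_15 {d m : ℕ}
    (f₀ : EuclideanSpace ℝ (Fin d) → EuclideanSpace ℝ (Fin d))
    (f : Fin m → EuclideanSpace ℝ (Fin d) → EuclideanSpace ℝ (Fin d))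
    (hf₀ : ContDiff ℝ 1 f₀) (hf : ∀ i, ContDiff ℝ 1 (f i))
    (C : ℝ) (hC : 0 < C)
    (hgrow₀ : ∀ x, ‖f₀ x‖ ≤ C * (1 + ‖x‖))
    (hgrow : ∀ i x, ‖f i x‖ ≤ C * (1 + ‖x‖))
    (U : Set (Fin m → ℝ)) (hUne : U.Nonempty) (hUcomp : IsCompact U)
    (hUconv : Convex ℝ U)
    (Ω : Set (EuclideanSpace ℝ (Fin d))) (hΩne : Ω.Nonempty) (hΩcomp : IsCompact Ω)
    (T : ℝ) (hT : 0 < T) :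
    IsCompact {y : EuclideanSpace ℝ (Fin d) |
      ∃ (x₀ : EuclideanSpace ℝ (Fin d)) (u : ℝ → Fin m → ℝ)
        (x : ℝ → EuclideanSpace ℝ (Fin d)),
        x₀ ∈ Ω ∧ Measurable u ∧
        (∀ᵐ t ∂(volume.restrict (Set.Icc (0:ℝ) T)), u t ∈ U) ∧
        ContinuousOn x (Set.Icc (0:ℝ) T) ∧ x 0 = x₀ ∧
        (∀ t ∈ Set.Icc (0:ℝ) T,
          x t = x₀ + ∫ s in Set.Ioc (0:ℝ) t, (f₀ (x s) + ∑ i, u s i • f i (x s))) ∧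
        x T = y} := by
  have hT0 := hT.le
  obtain ⟨B', hB'⟩ := hUcomp.isBounded.exists_norm_le
  obtain ⟨r, hr⟩ := hΩcomp.isBounded.exists_norm_le
  obtain ⟨B, hB⟩ : ∃ B : NNReal, ∀ v ∈ U, ‖v‖ ≤ B :=
    ⟨B'.toNNReal, fun v hv => (hB' v hv).trans (Real.le_coe_toNNReal _)⟩
  set K : ℝ := C * (1 + m * B) with hKdef
  have hK0 : 0 ≤ K := by positivity
  have hhb : ∀ (v : Fin m → ℝ) (z : EuclideanSpace ℝ (Fin d)), v ∈ U →
      ‖f₀ z + ∑ i, v i • f i z‖ ≤ K * (1 + ‖z‖) := by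
    intro v z hv
    have h1 : ‖∑ i, v i • f i z‖ ≤ ∑ i : Fin m, (B:ℝ) * (C * (1 + ‖z‖)) := by
      refine norm_sum_le_of_le _ fun i _ => ?_
      rw [norm_smul]
      exact mul_le_mul ((norm_le_pi_norm v i).trans (hB v hv)) (hgrow i z) (norm_nonneg _) B.2
    rw [Finset.sum_const, Finset.card_univ, Fintype.card_fin, nsmul_eq_mul] at h1
    calc _ ≤ _ := norm_add_le _ _
      _ ≤ _ := add_le_add (hgrow₀ z) h1
      _ = _ := by rw [hKdef]; ring
  set R : ℝ := r + K * gronwallBound 0 K (1 + r) T with hR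
  have hbound : ∀ (x₀ : EuclideanSpace ℝ (Fin d)) (u : ℝ → Fin m → ℝ)
      (x : ℝ → EuclideanSpace ℝ (Fin d)), x₀ ∈ Ω →
      (∀ᵐ t ∂(volume.restrict (Set.Icc (0:ℝ) T)), u t ∈ U) →
      ContinuousOn x (Set.Icc (0:ℝ) T) →
      (∀ t ∈ Set.Icc (0:ℝ) T,
        x t = x₀ + ∫ s in Set.Ioc (0:ℝ) t, (f₀ (x s) + ∑ i, u s i • f i (x s))) →
      ∀ t ∈ Set.Icc (0:ℝ) T, ‖x t‖ ≤ R := by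
    intro x₀ u x hx₀ huU hx heq
    exact aux_gronwall hT0 x _ x₀ r K hK0 (hr _ hx₀) hx heq (huU.mono fun t ht => hhb _ _ ht)
  have hTmem : T ∈ Set.Icc (0:ℝ) T := ⟨hT0, le_rfl⟩
  have h0mem : (0:ℝ) ∈ Set.Icc (0:ℝ) T := ⟨le_rfl, hT0⟩
  refine Metric.isCompact_of_isClosed_isBounded ?_ ?_
  swap
  · refine isBounded_iff_forall_norm_le.2 ⟨R, ?_⟩
    rintro y ⟨x₀, u, x, hx₀, hum, huU, hx, hx0, heq, rfl⟩
    exact hbound x₀ u x hx₀ huU hx heq T hTmem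
  apply IsSeqClosed.isClosed
  intro ys y hys hy
  choose x₀ u x hx₀ hum huU hx hx0 heq hxT using hys
  have hxR : ∀ n, ∀ t ∈ Set.Icc (0:ℝ) T, ‖x n t‖ ≤ R := fun n =>
    hbound (x₀ n) (u n) (x n) (hx₀ n) (huU n) (hx n) (heq n)
  have hR0 : 0 ≤ R := (norm_nonneg _).trans (hxR 0 0 h0mem)
  have huB : ∀ {w : ℝ → Fin m → ℝ}, (∀ᵐ t ∂(volume.restrict (Set.Icc (0:ℝ) T)), w t ∈ U) →
      ∀ t ∈ Set.Icc (0:ℝ) T, ∀ i, ∀ᵐ s ∂(volume.restrict (Set.Ioc (0:ℝ) t)), ‖w s i‖ ≤ B := by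
    intro w hw t ht i
    have hsub : Set.Ioc (0:ℝ) t ⊆ Set.Icc 0 T := fun s hs => ⟨hs.1.le, hs.2.trans ht.2⟩
    filter_upwards [ae_restrict_of_ae_restrict_of_subset hsub hw] with s hs
    exact (norm_le_pi_norm _ i).trans (hB _ hs)
  -- integrability of the pieces
  have int0 : ∀ z : ℝ → EuclideanSpace ℝ (Fin d), ContinuousOn z (Set.Icc 0 T) →
      ∀ t ∈ Set.Icc (0:ℝ) T, IntervalIntegrable (fun s => f₀ (z s)) volume 0 t := by
    intro z hz t ht
    apply ContinuousOn.intervalIntegrable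
    rw [Set.uIcc_of_le ht.1]
    exact hf₀.continuous.comp_continuousOn (hz.mono (Set.Icc_subset_Icc_right ht.2))
  have inti : ∀ (w : ℝ → Fin m → ℝ) (z : ℝ → EuclideanSpace ℝ (Fin d)), Measurable w →
      (∀ᵐ t ∂(volume.restrict (Set.Icc (0:ℝ) T)), w t ∈ U) → ContinuousOn z (Set.Icc 0 T) →
      ∀ t ∈ Set.Icc (0:ℝ) T, ∀ i, IntervalIntegrable (fun s => w s i • f i (z s)) volume 0 t := by
    intro w z hw hwU hz t ht i
    exact aux_integrable ht.1 (fun s => w s i) B ((measurable_pi_apply i).comp hw) (huB hwU t ht i)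
      (fun s => f i (z s)) ((hf i).continuous.comp_continuousOn (hz.mono (Set.Icc_subset_Icc_right ht.2)))
  have split : ∀ (w : ℝ → Fin m → ℝ) (z : ℝ → EuclideanSpace ℝ (Fin d)), Measurable w →
      (∀ᵐ t ∂(volume.restrict (Set.Icc (0:ℝ) T)), w t ∈ U) → ContinuousOn z (Set.Icc 0 T) →
      ∀ t ∈ Set.Icc (0:ℝ) T, IntervalIntegrable (fun s => f₀ (z s) + ∑ i, w s i • f i (z s)) volume 0 t ∧
      ∫ s in Set.Ioc (0:ℝ) t, (f₀ (z s) + ∑ i, w s i • f i (z s)) =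
        (∫ s in (0:ℝ)..t, (1:ℝ) • f₀ (z s)) + ∑ i, ∫ s in (0:ℝ)..t, w s i • f i (z s) := by
    intro w z hw hwU hz t ht
    have hs : IntervalIntegrable (fun s => ∑ i, w s i • f i (z s)) volume 0 t := by
      have := IntervalIntegrable.sum Finset.univ (fun i _ => inti w z hw hwU hz t ht i)
      simpa [Finset.sum_fn] using this
    refine ⟨(int0 z hz t ht).add hs, ?_⟩
    rw [← intervalIntegral.integral_of_le ht.1, intervalIntegral.integral_add (int0 z hz t ht) hs,
      intervalIntegral.integral_finsetSum (fun i _ => inti w z hw hwU hz t ht i)]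
    simp
  -- equi-Lipschitz
  obtain ⟨L, hL⟩ : ∃ L : NNReal, ∀ n, LipschitzOnWith L (x n) (Set.Icc 0 T) := by
    refine ⟨⟨K * (1 + R), by positivity⟩, fun n => ?_⟩
    apply LipschitzOnWith.of_dist_le_mul
    intro t ht s hs
    have e : x n t - x n s = ∫ r in s..t, (f₀ (x n r) + ∑ i, u n r i • f i (x n r)) := by
      rw [heq n t ht, heq n s hs, add_sub_add_left_eq_sub, ← intervalIntegral.integral_of_le ht.1,
        ← intervalIntegral.integral_of_le hs.1]
      exact intervalIntegral.integral_interval_sub_left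
        (split (u n) (x n) (hum n) (huU n) (hx n) t ht).1 (split (u n) (x n) (hum n) (huU n) (hx n) s hs).1
    rw [dist_eq_norm, e, Real.dist_eq]
    apply intervalIntegral.norm_integral_le_of_norm_le_const_ae
    filter_upwards [(ae_restrict_iff' measurableSet_Icc).1 (huU n)] with q hq hq'
    have hq2 := (Set.uIoc_subset_uIcc.trans (Set.uIcc_subset_Icc hs ht)) hq'
    refine (hhb _ _ (hq hq2)).trans ?_
    exact mul_le_mul_of_nonneg_left (by linarith [hxR n q hq2]) hK0
  obtain ⟨φ, z, hφ, hzL, hz⟩ := aux_arzela hT0 x L R hL hxR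
  obtain ⟨ψ, w, hψ, hwm, hwU, hw⟩ := aux_control hUcomp hUconv hT0 B hB (fun n => u (φ n))
    (fun n => hum _) (fun n => huU _)
  have hz' : ∀ t ∈ Set.Icc (0:ℝ) T, Tendsto (fun n => x (φ (ψ n)) t) atTop (𝓝 (z t)) :=
    fun t ht => (hz t ht).comp hψ.tendsto_atTop
  have hzR : ∀ t ∈ Set.Icc (0:ℝ) T, ‖z t‖ ≤ R := fun t ht =>
    le_of_tendsto (hz t ht).norm (Eventually.of_forall fun n => hxR _ t ht)
  have hlip : ∀ g : EuclideanSpace ℝ (Fin d) → EuclideanSpace ℝ (Fin d), ContDiff ℝ 1 g →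
      ∃ K' : NNReal, LipschitzOnWith K' (fun s => g (z s)) (Set.Icc 0 T) := by
    intro g hg
    obtain ⟨Kg, hKg⟩ := LocallyLipschitzOn.exists_lipschitzOnWith_of_compact
      (isCompact_closedBall (0 : EuclideanSpace ℝ (Fin d)) R) (hg.locallyLipschitz.locallyLipschitzOn)
    exact ⟨Kg * L, hKg.comp hzL (fun t ht => by simpa using hzR t ht)⟩
  have hlimg : ∀ (g : EuclideanSpace ℝ (Fin d) → EuclideanSpace ℝ (Fin d)), ContDiff ℝ 1 g →
      (∀ q, ‖g q‖ ≤ C * (1 + ‖q‖)) → ∀ (a : ℕ → ℝ → ℝ) (a' : ℝ → ℝ) (M : ℝ),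
      (∀ n, Measurable (a n)) → Measurable a' → ∀ t ∈ Set.Icc (0:ℝ) T,
      (∀ n, ∀ᵐ s ∂(volume.restrict (Set.Ioc (0:ℝ) t)), ‖a n s‖ ≤ M) →
      (∀ᵐ s ∂(volume.restrict (Set.Ioc (0:ℝ) t)), ‖a' s‖ ≤ M) →
      (∀ s ∈ Set.Icc (0:ℝ) T, Tendsto (fun n => ∫ r in (0:ℝ)..s, a n r) atTop
        (𝓝 (∫ r in (0:ℝ)..s, a' r))) →
      Tendsto (fun n => ∫ s in (0:ℝ)..t, a n s • g (x (φ (ψ n)) s)) atTop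
        (𝓝 (∫ s in (0:ℝ)..t, a' s • g (z s))) := by
    intro g hg hgg a a' M ham ham' t ht hM hM' hl
    obtain ⟨K', hK'⟩ := hlip g hg
    have hsub : Set.Icc (0:ℝ) t ⊆ Set.Icc 0 T := Set.Icc_subset_Icc_right ht.2
    refine aux_prod_vec ht.1 a a' M (C * (1 + R)) ham ham' hM hM' (fun s hs => hl s (hsub hs))
      (fun n s => g (x (φ (ψ n)) s)) (fun s => g (z s)) K' ?_ ?_ (hK'.mono hsub) ?_
    · exact fun n => hg.continuous.comp_continuousOn ((hx _).mono hsub)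
    · intro n s hs
      refine (hgg _).trans (mul_le_mul_of_nonneg_left ?_ hC.le)
      linarith [hxR (φ (ψ n)) s (hsub hs)]
    · exact fun s hs => (hg.continuous.tendsto _).comp (hz' s (hsub hs))
  have hx00 : ∀ n, x₀ n = x n 0 := fun n => (hx0 n).symm
  refine ⟨z 0, w, z, ?_, hwm, hwU, hzL.continuousOn, rfl, ?_, ?_⟩
  · exact hΩcomp.isClosed.mem_of_tendsto (hz 0 h0mem) (Eventually.of_forall fun n => by
      rw [hx0]; exact hx₀ _)
  · intro t ht
    refine tendsto_nhds_unique (hz' t ht) ?_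
    rw [(split w z hwm hwU hzL.continuousOn t ht).2]
    have e : ∀ n, x (φ (ψ n)) t = x (φ (ψ n)) 0 + ((∫ s in (0:ℝ)..t, (1:ℝ) • f₀ (x (φ (ψ n)) s)) +
        ∑ i, ∫ s in (0:ℝ)..t, u (φ (ψ n)) s i • f i (x (φ (ψ n)) s)) := by
      intro n
      rw [heq _ t ht, (split _ _ (hum _) (huU _) (hx _) t ht).2, hx0]
    simp only [e]
    refine (hz' 0 h0mem).add (Tendsto.add ?_ (tendsto_finsetSum _ fun i _ => ?_))
    · exact hlimg f₀ hf₀ hgrow₀ (fun _ _ => 1) (fun _ => 1) 1 (fun _ => measurable_const)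
        measurable_const t ht (fun n => by simp) (by simp) (fun s hs => tendsto_const_nhds)
    · exact hlimg (f i) (hf i) (hgrow i) (fun n s => u (φ (ψ n)) s i) (fun s => w s i) B
        (fun n => (measurable_pi_apply i).comp (hum _)) ((measurable_pi_apply i).comp hwm) t ht
        (fun n => huB (huU _) t ht i) (huB hwU t ht i) (fun s hs => hw s hs i)
  · refine tendsto_nhds_unique (hz' T hTmem) ?_
    simp only [hxT]
    exact hy.comp (hφ.comp hψ).tendsto_atTop
end
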